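/- Characterization of Â^N·Â* = Â*·Â^N: with the Hartwig–Spindelböck decomposition data as in the context and Â^N := Û · fromBlocks(K*Σ₁⁻¹, 0, L*Σ₁⁻¹, 0) · Û* (the NDMPI of Â), one has Â^N·Â* = Â*·Â^N if and only if Σ₂d·M_s = 0, L_s·Σ₂d·N_s = 0, and Σ₁²·K = K·Σ₁², where L_s, M_s, N_s denote the entrywise standard parts of L, M, N and Σ₂d denotes the dual part of Σ₂. -/

import Mathlib

open Matrix

/-- The dual complex numbers `𝔻ℂ := ℂ[ε]`, the trivial square-zero extension of `ℂ` by `ℂ`. -/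
abbrev DC := TrivSqZeroExt ℂ ℂ

/-- Star on dual complex numbers: `(a + b·ε)* = conj a + conj b · ε`. -/
instance : Star DC :=
  ⟨fun x => ((starRingEnd ℂ) x.fst, (starRingEnd ℂ) x.snd)⟩

/-- A positive appreciable real dual number: the standard part is a positive real and
the dual part is real. -/
def PosAppreciable (x : DC) : Prop :=
  (∃ a : ℝ, 0 < a ∧ x.fst = (a : ℂ)) ∧ (∃ b : ℝ, x.snd = (b : ℂ))

/-- A nonnegative infinitesimal real dual number: the standard part is `0` and
the dual part is a nonnegative real. -/
def NonnegInfinitesimal (x : DC) : Prop :=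
  x.fst = 0 ∧ ∃ b : ℝ, 0 ≤ b ∧ x.snd = (b : ℂ)

/-- The standard part of a dual complex matrix. -/
def stdPart {m n : Type*} (X : Matrix m n DC) : Matrix m n ℂ :=
  X.map TrivSqZeroExt.fst

/-- The dual part of a dual complex matrix. -/
def dualPart {m n : Type*} (X : Matrix m n DC) : Matrix m n ℂ :=
  X.map TrivSqZeroExt.snd

instance : StarRing DC where
  star_involutive x := by
    ext
    · exact Complex.conj_conj x.fst
    · exact Complex.conj_conj x.snd
  star_mul x y := by
    ext
    · change (starRingEnd ℂ) (x * y).fst = (starRingEnd ℂ) y.fst * (starRingEnd ℂ) x.fst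
      simp [mul_comm]
    · change (starRingEnd ℂ) (x * y).snd = (starRingEnd ℂ) y.fst • (starRingEnd ℂ) x.snd +
        MulOpposite.op ((starRingEnd ℂ) x.fst) • (starRingEnd ℂ) y.snd
      simp [mul_comm, add_comm]
  star_add x y := by
    ext
    · exact map_add (starRingEnd ℂ) x.fst y.fst
    · exact map_add (starRingEnd ℂ) x.snd y.snd

theorem stdPart_mul {l m n : Type*} [Fintype m] (X : Matrix l m DC) (Y : Matrix m n DC) :
    stdPart (X * Y) = stdPart X * stdPart Y := by
  ext i j
  simp [stdPart, Matrix.mul_apply, TrivSqZeroExt.fst_sum]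

theorem dualPart_mul {l m n : Type*} [Fintype m] (X : Matrix l m DC) (Y : Matrix m n DC) :
    dualPart (X * Y) = stdPart X * dualPart Y + dualPart X * stdPart Y := by
  ext i j
  simp [stdPart, dualPart, Matrix.mul_apply, TrivSqZeroExt.snd_sum, Finset.sum_add_distrib,
    mul_comm]

theorem eq_zero_iff_parts {m n : Type*} (X : Matrix m n DC) :
    X = 0 ↔ stdPart X = 0 ∧ dualPart X = 0 := by
  constructor
  · rintro rfl
    constructor <;> ext <;> simp [stdPart, dualPart]
  · rintro ⟨h₁, h₂⟩
    ext i j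
    · exact congrFun (congrFun h₁ i) j
    · exact congrFun (congrFun h₂ i) j

theorem infinitesimal_mul_eq_zero_iff {l m n : Type*} [Fintype m] {X : Matrix l m DC}
    (hX : stdPart X = 0) (Y : Matrix m n DC) :
    X * Y = 0 ↔ dualPart X * stdPart Y = 0 := by
  rw [eq_zero_iff_parts, stdPart_mul, dualPart_mul]
  simp [hX]

theorem PosAppreciable.isUnit {x : DC} (h : PosAppreciable x) : IsUnit x := by
  obtain ⟨⟨a, ha, hxa⟩, -⟩ := h
  rw [TrivSqZeroExt.isUnit_iff_isUnit_fst, hxa, isUnit_iff_ne_zero]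
  exact_mod_cast ha.ne'

theorem PosAppreciable.star_eq {x : DC} (h : PosAppreciable x) : star x = x := by
  obtain ⟨⟨a, -, hxa⟩, b, hxb⟩ := h
  ext
  · change (starRingEnd ℂ) x.fst = x.fst
    rw [hxa, Complex.conj_ofReal]
  · change (starRingEnd ℂ) x.snd = x.snd
    rw [hxb, Complex.conj_ofReal]

theorem NonnegInfinitesimal.star_eq {x : DC} (h : NonnegInfinitesimal x) : star x = x := by
  obtain ⟨hx, b, -, hxb⟩ := h
  ext
  · change (starRingEnd ℂ) x.fst = x.fst
    rw [hx, map_zero]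
  · change (starRingEnd ℂ) x.snd = x.snd
    rw [hxb, Complex.conj_ofReal]

theorem conj_left_cancel_iff {n : Type*} [Fintype n] [DecidableEq n] {U V X Y : Matrix n n DC}
    (hVU : V * U = 1) : U * X * V = U * Y * V ↔ X = Y := by
  refine ⟨fun h => ?_, fun h => by rw [h]⟩
  have key (Z : Matrix n n DC) : V * (U * Z * V) * U = Z := by
    rw [show V * (U * Z * V) * U = (V * U) * Z * (V * U) by simp only [Matrix.mul_assoc],
      hVU, Matrix.one_mul, Matrix.mul_one]
  rw [← key X, h, key]

/-- Characterization of `Â^N·Â* = Â*·Â^N`. -/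
theorem ndmpi_comm_conjTranspose_iff
    {r s : ℕ}
    -- `Û`, a unitary matrix
    (U : Matrix (Fin r ⊕ Fin s) (Fin r ⊕ Fin s) DC)
    (hU₁ : U * Uᴴ = 1) (hU₂ : Uᴴ * U = 1)
    -- the blocks `K, L, M, N` forming a unitary block matrix
    (K : Matrix (Fin r) (Fin r) DC) (L : Matrix (Fin r) (Fin s) DC)
    (M : Matrix (Fin s) (Fin r) DC) (N : Matrix (Fin s) (Fin s) DC)
    (hW₁ : fromBlocks K L M N * (fromBlocks K L M N)ᴴ = 1)
    (hW₂ : (fromBlocks K L M N)ᴴ * fromBlocks K L M N = 1)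
    -- `Σ₁` diagonal with positive appreciable real dual diagonal entries
    (S₁ : Matrix (Fin r) (Fin r) DC) (d₁ : Fin r → DC)
    (hS₁ : S₁ = Matrix.diagonal d₁) (hd₁ : ∀ i, PosAppreciable (d₁ i))
    -- `Σ₂` diagonal with nonnegative infinitesimal real dual diagonal entries
    (S₂ : Matrix (Fin s) (Fin s) DC) (d₂ : Fin s → DC)
    (hS₂ : S₂ = Matrix.diagonal d₂) (hd₂ : ∀ i, NonnegInfinitesimal (d₂ i))
    -- the Hartwig–Spindelböck decomposition of `Â`
    (A : Matrix (Fin r ⊕ Fin s) (Fin r ⊕ Fin s) DC)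
    (hA : A = U * fromBlocks (S₁ * K) (S₁ * L) (S₂ * M) (S₂ * N) * Uᴴ)
    -- `Â^N`, the NDMPI of `Â`
    (AN : Matrix (Fin r ⊕ Fin s) (Fin r ⊕ Fin s) DC)
    (hAN : AN = U * fromBlocks (Kᴴ * S₁⁻¹) 0 (Lᴴ * S₁⁻¹) 0 * Uᴴ) :
    AN * Aᴴ = Aᴴ * AN ↔
      dualPart S₂ * stdPart M = 0 ∧
      stdPart L * dualPart S₂ * stdPart N = 0 ∧
      S₁ ^ 2 * K = K * S₁ ^ 2 := by
  have hS₁H : S₁ᴴ = S₁ := by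
    rw [hS₁, diagonal_conjTranspose]
    exact congrArg _ (funext fun i => (hd₁ i).star_eq)
  have hS₂H : S₂ᴴ = S₂ := by
    rw [hS₂, diagonal_conjTranspose]
    exact congrArg _ (funext fun i => (hd₂ i).star_eq)
  have hdet : IsUnit S₁.det := by
    rw [hS₁, det_diagonal]
    exact IsUnit.prod_univ_iff.mpr fun i => (hd₁ i).isUnit
  have hr : S₁ * S₁⁻¹ = 1 := mul_nonsing_inv _ hdet
  have hl : S₁⁻¹ * S₁ = 1 := nonsing_inv_mul _ hdet
  have hS₂s : stdPart S₂ = 0 := by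
    ext i j
    rw [hS₂]
    by_cases hij : i = j
    · subst hij
      simpa [stdPart] using (hd₂ i).1
    · simp [stdPart, hij]
  have hrow : M * Mᴴ + N * Nᴴ = 1 := by
    have h := congrArg toBlocks₂₂ hW₁
    rwa [fromBlocks_conjTranspose, fromBlocks_multiply, toBlocks_fromBlocks₂₂,
      ← fromBlocks_one, toBlocks_fromBlocks₂₂] at h
  set W := fromBlocks K L M N with hW
  set D : Matrix (Fin r ⊕ Fin s) (Fin r ⊕ Fin s) DC := fromBlocks S₁ 0 0 S₂ with hD
  set P : Matrix (Fin r ⊕ Fin s) (Fin r ⊕ Fin s) DC := fromBlocks S₁⁻¹ 0 0 0 with hP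
  have hA' : Aᴴ = U * (Wᴴ * D) * Uᴴ := by
    have hDH : Dᴴ = D := by simp [hD, fromBlocks_conjTranspose, hS₁H, hS₂H]
    have hDW : fromBlocks (S₁ * K) (S₁ * L) (S₂ * M) (S₂ * N) = D * W := by
      simp [hD, hW, fromBlocks_multiply]
    rw [hA, hDW]
    simp only [conjTranspose_mul, conjTranspose_conjTranspose, hDH, Matrix.mul_assoc]
  have hAN' : AN = U * (Wᴴ * P) * Uᴴ := by
    rw [hAN]
    congr 2
    simp [hP, hW, fromBlocks_conjTranspose, fromBlocks_multiply]
  have hprod (X Y : Matrix (Fin r ⊕ Fin s) (Fin r ⊕ Fin s) DC) :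
      U * X * Uᴴ * (U * Y * Uᴴ) = U * (X * Y) * Uᴴ := by
    rw [show U * X * Uᴴ * (U * Y * Uᴴ) = U * X * (Uᴴ * U) * Y * Uᴴ by
      simp only [Matrix.mul_assoc], hU₂, Matrix.mul_one, Matrix.mul_assoc U X Y]
  have hcomm : AN * Aᴴ = Aᴴ * AN ↔ P * Wᴴ * D = D * Wᴴ * P := by
    rw [hA', hAN', hprod, hprod, conj_left_cancel_iff hU₂]
    refine ⟨fun h => ?_, fun h => ?_⟩
    · have h' := congrArg (W * ·) h
      simpa only [← Matrix.mul_assoc, hW₁, Matrix.one_mul] using h'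
    · simpa only [Matrix.mul_assoc] using congrArg (Wᴴ * ·) h
  have hblocks : P * Wᴴ * D = D * Wᴴ * P ↔
      S₁⁻¹ * Kᴴ * S₁ = S₁ * Kᴴ * S₁⁻¹ ∧ S₁⁻¹ * Mᴴ * S₂ = 0 ∧ 0 = S₂ * Lᴴ * S₁⁻¹ := by
    simp [hP, hD, hW, fromBlocks_conjTranspose, fromBlocks_multiply, fromBlocks_inj]
  have hK : S₁⁻¹ * Kᴴ * S₁ = S₁ * Kᴴ * S₁⁻¹ ↔ S₁ ^ 2 * K = K * S₁ ^ 2 := by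
    have hH : S₁ ^ 2 * K = K * S₁ ^ 2 ↔ Kᴴ * S₁ ^ 2 = S₁ ^ 2 * Kᴴ := by
      rw [← conjTranspose_inj]
      simp [conjTranspose_mul, conjTranspose_pow, hS₁H]
    rw [hH]
    refine ⟨fun h => ?_, fun h => ?_⟩
    · calc Kᴴ * S₁ ^ 2 = (S₁ * S₁⁻¹) * Kᴴ * S₁ ^ 2 := by rw [hr, Matrix.one_mul]
        _ = S₁ * (S₁⁻¹ * Kᴴ * S₁) * S₁ := by simp only [pow_two, Matrix.mul_assoc]
        _ = S₁ ^ 2 * Kᴴ * (S₁⁻¹ * S₁) := by rw [h]; simp only [pow_two, Matrix.mul_assoc]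
        _ = S₁ ^ 2 * Kᴴ := by rw [hl, Matrix.mul_one]
    · calc S₁⁻¹ * Kᴴ * S₁ = S₁⁻¹ * Kᴴ * S₁ * (S₁ * S₁⁻¹) := by rw [hr, Matrix.mul_one]
        _ = S₁⁻¹ * (Kᴴ * S₁ ^ 2) * S₁⁻¹ := by simp only [pow_two, Matrix.mul_assoc]
        _ = (S₁⁻¹ * S₁) * S₁ * Kᴴ * S₁⁻¹ := by rw [h]; simp only [pow_two, Matrix.mul_assoc]
        _ = S₁ * Kᴴ * S₁⁻¹ := by rw [hl, Matrix.one_mul]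
  have hM : S₁⁻¹ * Mᴴ * S₂ = 0 ↔ S₂ * M = 0 := by
    have hH : S₂ * M = 0 ↔ Mᴴ * S₂ = 0 := by
      rw [← conjTranspose_eq_zero, conjTranspose_mul, hS₂H]
    rw [hH]
    refine ⟨fun h => ?_, fun h => by rw [Matrix.mul_assoc, h, Matrix.mul_zero]⟩
    rw [← Matrix.one_mul (Mᴴ * S₂), ← hr, Matrix.mul_assoc, ← Matrix.mul_assoc S₁⁻¹, h,
      Matrix.mul_zero]
  have hL : 0 = S₂ * Lᴴ * S₁⁻¹ ↔ L * S₂ = 0 := by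
    have hH : L * S₂ = 0 ↔ S₂ * Lᴴ = 0 := by
      rw [← conjTranspose_eq_zero, conjTranspose_mul, hS₂H]
    rw [hH]
    refine ⟨fun h => ?_, fun h => by rw [h, Matrix.zero_mul]⟩
    rw [← Matrix.mul_one (S₂ * Lᴴ), ← hl, ← Matrix.mul_assoc, ← h, Matrix.zero_mul]
  have hLN : L * S₂ * N = 0 ↔ stdPart L * dualPart S₂ * stdPart N = 0 := by
    rw [infinitesimal_mul_eq_zero_iff (by rw [stdPart_mul, hS₂s, Matrix.mul_zero]),
      dualPart_mul, hS₂s, Matrix.mul_zero, add_zero]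
  rw [hcomm, hblocks, hK, hM, hL, ← infinitesimal_mul_eq_zero_iff hS₂s, ← hLN]
  refine ⟨fun ⟨h₁, h₂, h₃⟩ => ⟨h₂, by rw [h₃, Matrix.zero_mul], h₁⟩,
    fun ⟨h₁, h₂, h₃⟩ => ⟨h₃, h₁, ?_⟩⟩
  calc L * S₂ = L * S₂ * (M * Mᴴ + N * Nᴴ) := by rw [hrow, Matrix.mul_one]
    _ = L * (S₂ * M) * Mᴴ + L * S₂ * N * Nᴴ := by simp only [Matrix.mul_add, Matrix.mul_assoc]
    _ = 0 := by rw [h₁, h₂]; simp
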